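/- Fix an integer D ≥ 3 and let (V, σ_0, …, σ_D) be a connected edge (D+1)-colored graph with V nonempty. Define the rational numbers ω̂ := D + D(D−1)/4 · |V| − F, where F is the total number of faces; ω̂⁰ := (D−1)·c⁰ + (D−1)(D−2)/4 · |V| − F⁰, where F⁰ := Σ_{1 ≤ i < j ≤ D} F^{(ij)} is the number of faces not involving the color 0 and c⁰ is the number of orbits of the subgroup generated by σ_1, …, σ_D acting on V; and the SYK degree Ω := ω̂ − ω̂⁰. Then (1/D)·ω̂ ≤ Ω ≤ ω̂; in particular Ω is non-negative and Ω = 0 forces ω̂ = 0. -/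

import Mathlib

namespace ColoredGraph

open Module Finset

variable {ι V : Type*}

/-- The `𝔽₂`-valued functions on the vertices that are constant along every edge whose color
lies in `S`. -/
def invariants (σ : ι → Equiv.Perm V) (S : Set ι) : Submodule (ZMod 2) (V → ZMod 2) where
  carrier := {f | ∀ i ∈ S, ∀ v, f (σ i v) = f v}
  add_mem' hf hg i hi v := by simp [hf i hi v, hg i hi v]
  zero_mem' _ _ _ := rfl
  smul_mem' c f hf i hi v := by simp [hf i hi v]

theorem mem_invariants {σ : ι → Equiv.Perm V} {S : Set ι} {f : V → ZMod 2} :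
    f ∈ invariants σ S ↔ ∀ i ∈ S, ∀ v, f (σ i v) = f v := Iff.rfl

theorem invariants_union (σ : ι → Equiv.Perm V) (S T : Set ι) :
    invariants σ (S ∪ T) = invariants σ S ⊓ invariants σ T := by
  ext f
  simp only [Submodule.mem_inf, mem_invariants, Set.mem_union, or_imp, forall_and]

theorem invariants_anti (σ : ι → Equiv.Perm V) {S T : Set ι} (h : S ⊆ T) :
    invariants σ T ≤ invariants σ S := fun _ hf i hi => hf i (h hi)

theorem smul_eq_of_mem_invariants {σ : ι → Equiv.Perm V} {S : Set ι} {f : V → ZMod 2}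
    (hf : f ∈ invariants σ S) (g : Subgroup.closure (σ '' S)) (v : V) : f (g • v) = f v := by
  obtain ⟨g, hg⟩ := g
  change f (g v) = f v
  induction hg using Subgroup.closure_induction generalizing v with
  | mem x hx =>
    obtain ⟨i, hi, rfl⟩ := hx
    exact hf i hi v
  | one => rfl
  | mul x y _ _ hx hy => rw [Equiv.Perm.mul_apply, hx, hy]
  | inv x _ hx => simpa using (hx (x⁻¹ v)).symm

/-- The number of connected components of the graph that retains only the colors in `S`. -/
noncomputable def numComponents (σ : ι → Equiv.Perm V) (S : Set ι) : ℕ :=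
  Nat.card (MulAction.orbitRel.Quotient (Subgroup.closure (σ '' S)) V)

theorem numComponents_pair (σ : ι → Equiv.Perm V) (i j : ι) : numComponents σ {i, j} =
    Nat.card (MulAction.orbitRel.Quotient (Subgroup.closure {σ i, σ j}) V) := by
  rw [numComponents, Set.image_pair]

/-- Functions invariant under the colors in `S` are functions on the set of orbits. -/
def invariantsEquiv (σ : ι → Equiv.Perm V) (S : Set ι) :
    invariants σ S ≃ₗ[ZMod 2]
      (MulAction.orbitRel.Quotient (Subgroup.closure (σ '' S)) V → ZMod 2) where
  toFun f := Quotient.lift f.1 (by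
    rintro v w ⟨g, rfl⟩
    exact smul_eq_of_mem_invariants f.2 g w)
  map_add' f g := by
    ext q
    induction q using Quotient.inductionOn
    rfl
  map_smul' c f := by
    ext q
    induction q using Quotient.inductionOn
    rfl
  invFun h := ⟨fun v => h (Quotient.mk _ v), fun i hi v => congrArg h <| Quotient.sound
    ⟨⟨σ i, Subgroup.subset_closure (Set.mem_image_of_mem σ hi)⟩, rfl⟩⟩
  left_inv _ := rfl
  right_inv h := by
    ext q
    induction q using Quotient.inductionOn
    rfl

variable [Fintype V]

theorem finrank_invariants (σ : ι → Equiv.Perm V) (S : Set ι) :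
    finrank (ZMod 2) (invariants σ S) = numComponents σ S := by
  classical
  have : Fintype (MulAction.orbitRel.Quotient (Subgroup.closure (σ '' S)) V) :=
    Fintype.ofFinite _
  rw [(invariantsEquiv σ S).finrank_eq, finrank_fintype_fun_eq_card, numComponents,
    Nat.card_eq_fintype_card]

theorem numComponents_submodular (σ : ι → Equiv.Perm V) {P S : Set ι} (hPS : P ⊆ S)
    (T : Set ι) :
    numComponents σ S + numComponents σ (P ∪ T) ≤
      numComponents σ P + numComponents σ (S ∪ T) := by
  simp only [← finrank_invariants]
  have h := Submodule.finrank_sup_add_finrank_inf_eq (invariants σ S) (invariants σ (P ∪ T))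
  rw [← invariants_union, ← Set.union_assoc, Set.union_eq_left.2 hPS] at h
  have := Submodule.finrank_mono (sup_le (invariants_anti σ hPS)
    (invariants_anti σ (Set.subset_union_left (s := P) (t := T))))
  omega

theorem two_mul_numComponents_singleton_le {σ : ι → Equiv.Perm V} {i : ι}
    (hfpf : ∀ v, σ i v ≠ v) : 2 * numComponents σ {i} ≤ Fintype.card V := by
  classical
  have : Fintype (MulAction.orbitRel.Quotient (Subgroup.closure (σ '' {i})) V) :=
    Fintype.ofFinite _
  rw [numComponents, Nat.card_eq_fintype_card, ← card_univ, ← card_univ]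
  refine mul_card_image_le_card_of_maps_to (f := Quotient.mk _) (fun _ _ => mem_univ _) 2 ?_
  intro q _
  induction q using Quotient.inductionOn with
  | h v =>
    refine one_lt_card.2 ⟨σ i v, ?_, v, by simp, hfpf v⟩
    simp only [mem_filter, mem_univ, true_and]
    exact Quotient.sound ⟨⟨σ i, Subgroup.subset_closure ⟨i, rfl, rfl⟩⟩, rfl⟩

/-- The functions constant along the edges of some color in `S` span a subspace whose codimension
is at most the number of components: a linear form that vanishes on all of them takes the same
value on the indicators of adjacent vertices. -/
theorem card_le_finrank_add_numComponents {σ : ι → Equiv.Perm V} {S : Set ι}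
    (hinv : ∀ i v, σ i (σ i v) = v)
    {W : Submodule (ZMod 2) (V → ZMod 2)} (hW : ∀ i ∈ S, invariants σ {i} ≤ W) :
    Fintype.card V ≤ finrank (ZMod 2) W + numComponents σ S := by
  classical
  have h := Subspace.finrank_add_finrank_dualAnnihilator_eq W
  rw [finrank_fintype_fun_eq_card] at h
  suffices finrank (ZMod 2) W.dualAnnihilator ≤ numComponents σ S by omega
  rw [← finrank_invariants, ← LinearEquiv.finrank_map_eq (dotProductEquiv (ZMod 2) V).symm]
  refine Submodule.finrank_mono ?_
  rintro _ ⟨φ, hφ, rfl⟩ i hi v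
  have hmem : Pi.single (σ i v) 1 + Pi.single v 1 ∈ invariants σ {i} := by
    rintro _ rfl w
    simp only [Pi.add_apply, Pi.single_apply, EmbeddingLike.apply_eq_iff_eq]
    rw [add_comm]
    congr 2
    rw [eq_iff_iff]
    constructor <;> intro h
    · rw [← h, hinv]
    · rw [h, hinv]
  have hzero := (Submodule.mem_dualAnnihilator φ).1 hφ _ (hW i hi hmem)
  rw [map_add, CharTwo.add_eq_zero] at hzero
  exact hzero

/-- Euler's inequality for the surface with faces bounded by the bicolored cycles of a
three-colored graph. -/
theorem two_mul_faces_le {σ : ι → Equiv.Perm V}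
    (hinv : ∀ i v, σ i (σ i v) = v) (hfpf : ∀ i v, σ i v ≠ v) (a b c : ι) :
    2 * (numComponents σ {a, b} + numComponents σ {a, c} + numComponents σ {b, c}) ≤
      Fintype.card V + 4 * numComponents σ {a, b, c} := by
  have ha := two_mul_numComponents_singleton_le (hfpf a)
  have hb := two_mul_numComponents_singleton_le (hfpf b)
  have hc := two_mul_numComponents_singleton_le (hfpf c)
  have hW := card_le_finrank_add_numComponents (S := {a, b, c}) hinv
    (W := invariants σ {a} ⊔ invariants σ {b} ⊔ invariants σ {c}) (by
      rintro i (rfl | rfl | rfl)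
      · exact le_sup_left.trans le_sup_left
      · exact le_sup_right.trans le_sup_left
      · exact le_sup_right)
  have hpair (i j : ι) : invariants σ {i, j} = invariants σ {i} ⊓ invariants σ {j} := by
    rw [Set.insert_eq, invariants_union]
  have htriple : invariants σ {a, c} ⊓ invariants σ {b, c} = invariants σ {a, b, c} := by
    rw [← invariants_union]
    congr 1
    grind
  have h1 := Submodule.finrank_sup_add_finrank_inf_eq (invariants σ {a}) (invariants σ {b})
  have h2 := Submodule.finrank_sup_add_finrank_inf_eq
    (invariants σ {a} ⊔ invariants σ {b}) (invariants σ {c})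
  have h3 := Submodule.finrank_sup_add_finrank_inf_eq (invariants σ {a, c}) (invariants σ {b, c})
  have hle : invariants σ {a, c} ⊔ invariants σ {b, c} ≤
      (invariants σ {a} ⊔ invariants σ {b}) ⊓ invariants σ {c} := by
    rw [hpair, hpair]
    exact sup_le (inf_le_inf_right _ le_sup_left) (inf_le_inf_right _ le_sup_right)
  have h4 := Submodule.finrank_mono hle
  rw [← hpair] at h1
  rw [htriple] at h3
  simp only [finrank_invariants] at h1 h2 h3 h4
  omega

/-- The change of Euler characteristic when a color `x` is inserted, between the colors `a`
and `b`, into a cyclic ordering of `S`. -/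
theorem faces_insert_le {σ : ι → Equiv.Perm V}
    (hinv : ∀ i v, σ i (σ i v) = v) (hfpf : ∀ i v, σ i v ≠ v) {S : Set ι} {a b : ι}
    (ha : a ∈ S) (hb : b ∈ S) (x : ι) :
    2 * (numComponents σ {a, x} + numComponents σ {b, x}) + 4 * numComponents σ S ≤
      Fintype.card V + 4 * numComponents σ (insert x S) + 2 * numComponents σ {a, b} := by
  have h1 := two_mul_faces_le hinv hfpf a b x
  have h2 := numComponents_submodular σ (P := {a, b}) (S := S)
    (Set.insert_subset ha (Set.singleton_subset_iff.2 hb)) {x}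
  rw [Set.union_singleton, Set.union_singleton,
    show insert x {a, b} = ({a, b, x} : Set ι) by grind] at h2
  omega

/-- The reduced degree of the graph that retains only the colors in `S`, with the pairs of
colors counted twice in the sum over faces. -/
noncomputable def degree [DecidableEq ι] (σ : ι → Equiv.Perm V) (S : Finset ι) : ℚ :=
  ((#S : ℚ) - 1) * numComponents σ S + (((#S : ℚ) - 1) * ((#S : ℚ) - 2) / 4) * Fintype.card V
    - (∑ p ∈ S.offDiag, (numComponents σ {p.1, p.2} : ℚ)) / 2

theorem sum_offDiag_insert [DecidableEq ι] (f : ι → ι → ℚ) (hf : ∀ i j, f i j = f j i)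
    {S : Finset ι} {x : ι} (hx : x ∉ S) :
    ∑ p ∈ (insert x S).offDiag, f p.1 p.2 =
      ∑ p ∈ S.offDiag, f p.1 p.2 + 2 * ∑ a ∈ S, f a x := by
  rw [offDiag_insert hx, sum_union, sum_union, sum_product, sum_product]
  · simp only [sum_singleton, hf x]
    ring
  · rw [disjoint_left]
    grind
  · rw [disjoint_left]
    grind

theorem sum_offDiag_fst_add_snd [DecidableEq ι] (g : ι → ℚ) (S : Finset ι) :
    ∑ p ∈ S.offDiag, (g p.1 + g p.2) = 2 * ((#S : ℚ) - 1) * ∑ a ∈ S, g a := by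
  have h := sum_union (disjoint_diag_offDiag S) (f := fun p => g p.1 + g p.2)
  rw [diag_union_offDiag, sum_product, sum_diag] at h
  simp only [sum_add_distrib, sum_const, nsmul_eq_mul, ← mul_sum] at h ⊢
  linarith

theorem card_mul_degree_le [DecidableEq ι] {σ : ι → Equiv.Perm V}
    (hinv : ∀ i v, σ i (σ i v) = v) (hfpf : ∀ i v, σ i v ≠ v) {S : Finset ι}
    {x : ι} (hx : x ∉ S) :
    (#S : ℚ) * degree σ S ≤ ((#S : ℚ) - 1) * degree σ (insert x S) := by
  have hsum : ∑ p ∈ S.offDiag, (2 * ((numComponents σ {p.1, x} : ℚ) + numComponents σ {p.2, x})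
        + 4 * numComponents σ (S : Set ι)) ≤
      ∑ p ∈ S.offDiag, ((Fintype.card V : ℚ) + 4 * numComponents σ (insert x (S : Set ι)) +
        2 * numComponents σ {p.1, p.2}) := by
    refine sum_le_sum fun p hp => ?_
    rw [mem_offDiag] at hp
    exact_mod_cast faces_insert_le hinv hfpf (S := (S : Set ι)) hp.1 hp.2.1 x
  rw [sum_add_distrib, sum_add_distrib, ← mul_sum, ← mul_sum,
    sum_offDiag_fst_add_snd (fun a => (numComponents σ {a, x} : ℚ)), sum_const, sum_const,
    ← mul_sum, offDiag_card, nsmul_eq_mul, nsmul_eq_mul, Nat.cast_sub (Nat.le_mul_self _),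
    Nat.cast_mul]
    at hsum
  rw [degree, degree, sum_offDiag_insert (fun i j => (numComponents σ {i, j} : ℚ))
    (fun i j => by rw [Set.pair_comm]) hx, card_insert_of_notMem hx, coe_insert]
  push_cast
  linarith

theorem degree_nonneg [DecidableEq ι] {σ : ι → Equiv.Perm V}
    (hinv : ∀ i v, σ i (σ i v) = v) (hfpf : ∀ i v, σ i v ≠ v) {S : Finset ι}
    (hS : S.Nontrivial) : 0 ≤ degree σ S := by
  induction S using Finset.induction_on with
  | empty => exact absurd hS not_nontrivial_empty
  | insert x S hx ih =>
    obtain ⟨a, rfl⟩ | hS' := (show S.Nonempty by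
      rw [nonempty_iff_ne_empty]
      rintro rfl
      simp at hS).exists_eq_singleton_or_nontrivial
    · rw [degree, sum_offDiag_insert (fun i j => (numComponents σ {i, j} : ℚ))
        (fun i j => by rw [Set.pair_comm]) hx, card_insert_of_notMem hx, coe_insert,
        coe_singleton, Set.pair_comm x a]
      simp
      norm_num
    · have hcard : (1 : ℚ) < #S := by exact_mod_cast one_lt_card_iff_nontrivial.2 hS'
      have h := card_mul_degree_le hinv hfpf hx
      have := mul_nonneg (zero_le_one.trans hcard.le) (ih hS')
      exact nonneg_of_mul_nonneg_right (this.trans h) (sub_pos.2 hcard)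

theorem sum_offDiag_eq_two_mul_sum_lt [LinearOrder ι] (f : ι → ι → ℚ)
    (hf : ∀ i j, f i j = f j i) (S : Finset ι) :
    ∑ p ∈ S.offDiag, f p.1 p.2 = 2 * ∑ p ∈ S.offDiag with p.1 < p.2, f p.1 p.2 := by
  rw [← sum_filter_add_sum_filter_not S.offDiag (fun p => p.1 < p.2), two_mul]
  congr 1
  refine sum_nbij' Prod.swap Prod.swap ?_ ?_ (fun _ _ => rfl) (fun _ _ => rfl)
    (fun p _ => hf p.1 p.2)
  all_goals
    simp only [mem_filter, mem_offDiag, Prod.fst_swap, Prod.snd_swap]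
    grind

end ColoredGraph

/-- **Bounds on the SYK degree.**  Let `D ≥ 3` and let `(V, σ)` be a connected edge
`(D+1)`-colored graph on a nonempty finite vertex type.  With
`ω̂ = D + D(D-1)/4·|V| - F` the reduced degree (where `F` is the total number of faces),
`ω̂⁰ = (D-1)·c⁰ + (D-1)(D-2)/4·|V| - F⁰` the reduced degree of the edge `D`-colored
graph obtained by erasing the color `0` (where `F⁰` counts the faces not involving the
color `0` and `c⁰` is its number of connected components), and the SYK degree
`Ω = ω̂ - ω̂⁰`, one has `(1/D)·ω̂ ≤ Ω ≤ ω̂`; in particular `Ω ≥ 0` and `Ω = 0`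
forces `ω̂ = 0`. -/
theorem syk_degree_bounds
    (D : ℕ) (hD : 3 ≤ D)
    (V : Type) [Fintype V] [Nonempty V]
    (σ : Fin (D + 1) → Equiv.Perm V)
    (hinv : ∀ i, σ i * σ i = 1) (hfpf : ∀ i v, σ i v ≠ v)
    (hconn : MulAction.IsPretransitive
      (Subgroup.closure (Set.range σ) : Subgroup (Equiv.Perm V)) V)
    (F F0 c0 : ℕ)
    (hF : F = ∑ ij ∈ Finset.univ.filter (fun ij : Fin (D + 1) × Fin (D + 1) => ij.1 < ij.2),
        Nat.card (MulAction.orbitRel.Quotient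
          (Subgroup.closure {σ ij.1, σ ij.2} : Subgroup (Equiv.Perm V)) V))
    (hF0 : F0 = ∑ ij ∈ Finset.univ.filter
          (fun ij : Fin (D + 1) × Fin (D + 1) => ij.1 ≠ 0 ∧ ij.1 < ij.2),
        Nat.card (MulAction.orbitRel.Quotient
          (Subgroup.closure {σ ij.1, σ ij.2} : Subgroup (Equiv.Perm V)) V))
    (hc0 : c0 = Nat.card (MulAction.orbitRel.Quotient
        (Subgroup.closure (σ '' {i : Fin (D + 1) | i ≠ 0}) : Subgroup (Equiv.Perm V)) V))
    (ω ω0 Ω : ℚ)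
    (hω : ω = (D : ℚ) + (D * (D - 1) / 4) * (Nat.card V : ℚ) - (F : ℚ))
    (hω0 : ω0 = ((D : ℚ) - 1) * (c0 : ℚ)
        + (((D : ℚ) - 1) * ((D : ℚ) - 2) / 4) * (Nat.card V : ℚ) - (F0 : ℚ))
    (hΩ : Ω = ω - ω0) :
    (1 / (D : ℚ)) * ω ≤ Ω ∧ Ω ≤ ω ∧ 0 ≤ Ω ∧ (Ω = 0 → ω = 0) := by
  classical
  have hinv' (i : Fin (D + 1)) (v : V) : σ i (σ i v) = v := Equiv.congr_fun (hinv i) v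
  have hD' : (3 : ℚ) ≤ D := by exact_mod_cast hD
  let S : Finset (Fin (D + 1)) := Finset.univ.erase 0
  have hcard : S.card = D := by simp [S]
  have hS : S.Nontrivial := Finset.one_lt_card_iff_nontrivial.1 (by omega)
  have hinsert : insert 0 S = Finset.univ := Finset.insert_erase (Finset.mem_univ _)
  have hfaces (T : Finset (Fin (D + 1))) :=
    ColoredGraph.sum_offDiag_eq_two_mul_sum_lt
      (fun i j => (ColoredGraph.numComponents σ {i, j} : ℚ))
      (fun i j => by rw [Set.pair_comm]) T
  have hone : ColoredGraph.numComponents σ Set.univ = 1 := by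
    rw [ColoredGraph.numComponents, Set.image_univ, Nat.card_eq_one_iff_unique]
    exact ⟨(MulAction.pretransitive_iff_subsingleton_quotient _ V).1 hconn,
      ‹Nonempty V›.map (Quotient.mk _)⟩
  have hdeg : ω = ColoredGraph.degree σ Finset.univ := by
    have hset : (Finset.univ : Finset (Fin (D + 1))).offDiag.filter (fun p => p.1 < p.2) =
        Finset.univ.filter (fun p => p.1 < p.2) := by
      ext p
      simp only [Finset.mem_filter, Finset.mem_offDiag, Finset.mem_univ, true_and]
      grind
    rw [ColoredGraph.degree, hfaces, hset, Finset.coe_univ, hone, hω, hF,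
      Nat.card_eq_fintype_card]
    simp only [ColoredGraph.numComponents_pair, Finset.card_univ, Fintype.card_fin]
    push_cast
    ring
  have hdeg0 : ω0 = ColoredGraph.degree σ S := by
    have hset : S.offDiag.filter (fun p => p.1 < p.2) =
        Finset.univ.filter (fun p => p.1 ≠ 0 ∧ p.1 < p.2) := by
      ext p
      simp only [S, Finset.mem_filter, Finset.mem_offDiag, Finset.mem_erase, Finset.mem_univ,
        true_and, and_true]
      constructor
      · grind
      · rintro ⟨h0, hlt⟩
        exact ⟨⟨h0, Fin.ne_zero_of_lt hlt, hlt.ne⟩, hlt⟩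
    have hcoe : (S : Set (Fin (D + 1))) = {i | i ≠ 0} := by
      ext i
      simp [S]
    rw [ColoredGraph.degree, hfaces, hset, hcoe, hcard, hω0, hF0, hc0,
      ← Nat.card_eq_fintype_card, ← ColoredGraph.numComponents]
    simp only [ColoredGraph.numComponents_pair]
    push_cast
    ring
  have hnonneg0 := ColoredGraph.degree_nonneg hinv' hfpf hS
  have hstep := ColoredGraph.card_mul_degree_le hinv' hfpf
    (Finset.notMem_erase 0 Finset.univ)
  rw [hinsert, ← hdeg, ← hdeg0, hcard] at hstep
  rw [← hdeg0] at hnonneg0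
  have hnonneg : 0 ≤ ω := by
    rw [hdeg]
    exact ColoredGraph.degree_nonneg hinv' hfpf (hS.mono (Finset.subset_univ S))
  have hlower : 1 / (D : ℚ) * ω ≤ Ω := by
    rw [one_div_mul_eq_div, div_le_iff₀ (by linarith), hΩ]
    linarith
  have hpos : 0 ≤ 1 / (D : ℚ) * ω := by positivity
  refine ⟨hlower, by linarith, hpos.trans hlower, fun h => ?_⟩
  have hzero : 1 / (D : ℚ) * ω = 0 := le_antisymm (h ▸ hlower) hpos
  exact (mul_eq_zero.1 hzero).resolve_left (by positivity)
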